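/- Let n ≥ 2 be an integer and ξ a real number with 2n−2 < ŵ_n(ξ) < ∞, and write w = ŵ_n(ξ). For every ε > 0 there exists k_0 such that for every integer k ≥ k_0 satisfying H_k > 2·H_{k−1}, the integer ℓ = ℓ(k) is finite and log H_ℓ / log H_k ≤ (((n−1)w − τ_k(w−n)) / (τ_k·(w−1)·(w−n)))·τ_ℓ + ε. -/

import Mathlib

open Polynomial Filter

noncomputable section

/-- Height of an integer polynomial: maximum absolute value of its coefficients. -/
def polyHeight (P : Polynomial ℤ) : ℕ :=
  P.support.sup fun i => (P.coeff i).natAbs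

/-- The set of exponents `w` admissible for the uniform exponent `ŵ_n(ξ)`. -/
def uniformExpSet (n : ℕ) (ξ : ℝ) : Set ℝ :=
  {w | ∀ᶠ X : ℝ in atTop, ∃ P : Polynomial ℤ, P.natDegree ≤ n ∧
    (polyHeight P : ℝ) ≤ X ∧ 0 < |Polynomial.aeval ξ P| ∧
    |Polynomial.aeval ξ P| < X ^ (-w)}

/-- The uniform exponent `ŵ_n(ξ)`, as an extended real. -/
def wHat (n : ℕ) (ξ : ℝ) : EReal :=
  sSup ((fun w : ℝ => (w : EReal)) '' uniformExpSet n ξ)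

/-- The set of exponents `w` admissible for the ordinary exponent `w_n(ξ)`. -/
def ordExpSet (n : ℕ) (ξ : ℝ) : Set ℝ :=
  {w | {P : Polynomial ℤ | P.natDegree ≤ n ∧ 0 < |Polynomial.aeval ξ P| ∧
      |Polynomial.aeval ξ P| < (polyHeight P : ℝ) ^ (-w)}.Infinite}

/-- The ordinary exponent `w_n(ξ)`, as an extended real. -/
def wOrd (n : ℕ) (ξ : ℝ) : EReal :=
  sSup ((fun w : ℝ => (w : EReal)) '' ordExpSet n ξ)

/-- `P` (1-indexed: the relevant values are `P 1, P 2, …`) is the sequence of best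
approximation polynomials associated to `(n, ξ)`. -/
structure IsBestApproxSeq (n : ℕ) (ξ : ℝ) (P : ℕ → Polynomial ℤ) : Prop where
  ne_zero : ∀ k, 1 ≤ k → P k ≠ 0
  deg_le : ∀ k, 1 ≤ k → (P k).natDegree ≤ n
  height_lt : ∀ k, 1 ≤ k → polyHeight (P k) < polyHeight (P (k+1))
  eval_lt : ∀ k, 1 ≤ k → |Polynomial.aeval ξ (P (k+1))| < |Polynomial.aeval ξ (P k)|
  isMin : ∀ k, 1 ≤ k → ∀ Q : Polynomial ℤ, Q ≠ 0 → Q.natDegree ≤ n →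
    polyHeight Q ≤ polyHeight (P k) →
    |Polynomial.aeval ξ (P k)| ≤ |Polynomial.aeval ξ Q|
  complete : ∀ Q : Polynomial ℤ, Q ≠ 0 → Q.natDegree ≤ n →
    (∀ R : Polynomial ℤ, R ≠ 0 → R.natDegree ≤ n → polyHeight R ≤ polyHeight Q →
      |Polynomial.aeval ξ Q| ≤ |Polynomial.aeval ξ R|) →
    ∃ k, 1 ≤ k ∧ (Q = P k ∨ Q = -P k)

/-- The image of an integer polynomial in `ℚ[X]`. -/
def ratPoly (P : Polynomial ℤ) : Polynomial ℚ := P.map (Int.castRingHom ℚ)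

/-- `k` is good for the sequence `P`: `P_{k-1}, P_k, P_{k+1}` are `ℚ`-linearly independent. -/
def Good (P : ℕ → Polynomial ℤ) (k : ℕ) : Prop :=
  LinearIndependent ℚ ![ratPoly (P (k-1)), ratPoly (P k), ratPoly (P (k+1))]

/-- `τ_k = log H_k / log H_{k-1}`. -/
def tauk (P : ℕ → Polynomial ℤ) (k : ℕ) : ℝ :=
  Real.log (polyHeight (P k)) / Real.log (polyHeight (P (k-1)))

/-- `μ_k = -log |P_{k-1}(ξ)| / log H_k`. -/
def muk (ξ : ℝ) (P : ℕ → Polynomial ℤ) (k : ℕ) : ℝ :=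
  - Real.log |Polynomial.aeval ξ (P (k-1))| / Real.log (polyHeight (P k))

/-- `v_k = -log |P_k(ξ)| / log H_k`. -/
def vk (ξ : ℝ) (P : ℕ → Polynomial ℤ) (k : ℕ) : ℝ :=
  - Real.log |Polynomial.aeval ξ (P k)| / Real.log (polyHeight (P k))

/-- The set of integers `m ≥ k+1` such that `P_{k-1}, …, P_{m-1}` all lie in the
two-dimensional space spanned by `P_{k-1}` and `P_k`; its greatest element is `ℓ(k)`. -/
def ellSet (P : ℕ → Polynomial ℤ) (k : ℕ) : Set ℕ :=
  {m | k + 1 ≤ m ∧ ∀ j, k - 1 ≤ j → j ≤ m - 1 →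
    ratPoly (P j) ∈ Submodule.span ℚ {ratPoly (P (k-1)), ratPoly (P k)}}

/-- The set `V_k = {P, T·P, …, T^{n-2}·P}` (as rational polynomials). -/
def Vset (n : ℕ) (A : Polynomial ℤ) : Set (Polynomial ℚ) :=
  {q | ∃ i ≤ n - 2, q = Polynomial.X ^ i * ratPoly A}

/-- The trajectory `L_P(q) = max(log H(P) - q/(2n-2), log |P(ξ)| + q)`. -/
def LPtraj (n : ℕ) (ξ : ℝ) (Q : Polynomial ℤ) (q : ℝ) : ℝ :=
  max (Real.log (polyHeight Q) - q / (2*(n:ℝ)-2)) (Real.log |Polynomial.aeval ξ Q| + q)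

/-- The `j`-th successive minimum function `L_j(q)`: the infimum over sets of `j`
linearly independent integer polynomials of degree at most `2n-2` of the maximum of
`L_P(q)` over the set. -/
def Lj (n : ℕ) (ξ : ℝ) (j : ℕ) (q : ℝ) : ℝ :=
  sInf {y : ℝ | ∃ S : Finset (Polynomial ℤ), S.card = j ∧
    (∀ Q ∈ S, Q.natDegree ≤ 2*n-2) ∧
    LinearIndependent ℚ (fun Q : {x // x ∈ S} => ratPoly (Q : Polynomial ℤ)) ∧
    y = sSup ((fun Q => LPtraj n ξ Q q) '' (S : Set (Polynomial ℤ)))}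


/-! ### Heights and Mahler measures -/

/-- The Mahler measure of an integer polynomial. -/
def intMahler (Q : ℤ[X]) : ℝ := (Q.map (Int.castRingHom ℂ)).mahlerMeasure

lemma natAbs_coeff_le_polyHeight (Q : ℤ[X]) (i : ℕ) : (Q.coeff i).natAbs ≤ polyHeight Q := by
  by_cases h : i ∈ Q.support
  · exact Finset.le_sup (f := fun i => (Q.coeff i).natAbs) h
  · simp [notMem_support_iff.mp h]

lemma abs_coeff_le_polyHeight (Q : ℤ[X]) (i : ℕ) : |(Q.coeff i : ℝ)| ≤ polyHeight Q := by
  rw [← Int.cast_abs, Int.abs_eq_natAbs]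
  exact_mod_cast natAbs_coeff_le_polyHeight Q i

lemma polyHeight_le_iff {Q : ℤ[X]} {x : ℝ} (hx : 0 ≤ x) :
    (polyHeight Q : ℝ) ≤ x ↔ ∀ i, |(Q.coeff i : ℝ)| ≤ x := by
  refine ⟨fun h i => (abs_coeff_le_polyHeight Q i).trans h, fun h => ?_⟩
  rw [← Nat.le_floor_iff hx]
  refine Finset.sup_le fun i _ => Nat.le_floor ?_
  rw [Nat.cast_natAbs, Int.cast_abs]
  exact h i

lemma exists_abs_coeff_eq_polyHeight {Q : ℤ[X]} (hQ : Q ≠ 0) :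
    ∃ i, |(Q.coeff i : ℝ)| = polyHeight Q := by
  obtain ⟨i, _, hi⟩ := Finset.exists_mem_eq_sup Q.support (nonempty_support_iff.mpr hQ)
    fun i => (Q.coeff i).natAbs
  refine ⟨i, ?_⟩
  rw [polyHeight, hi, Nat.cast_natAbs, Int.cast_abs]

lemma polyHeight_pos {Q : ℤ[X]} (hQ : Q ≠ 0) : 0 < polyHeight Q := by
  have h := natAbs_coeff_le_polyHeight Q Q.natDegree
  have : Q.coeff Q.natDegree ≠ 0 := by simpa using hQ
  have := Int.natAbs_pos.mpr this
  omega

lemma intMahler_mul (Q R : ℤ[X]) : intMahler (Q * R) = intMahler Q * intMahler R := by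
  simp [intMahler, mahlerMeasure_mul]

lemma one_le_intMahler {Q : ℤ[X]} (hQ : Q ≠ 0) : 1 ≤ intMahler Q :=
  one_le_mahlerMeasure_of_ne_zero hQ

lemma polyHeight_le_intMahler {n : ℕ} {Q : ℤ[X]} (hn : Q.natDegree ≤ n) :
    (polyHeight Q : ℝ) ≤ 2 ^ n * intMahler Q := by
  have h0 : 0 ≤ intMahler Q := mahlerMeasure_nonneg _
  rw [polyHeight_le_iff (by positivity)]
  intro i
  have h := norm_coeff_le_choose_mul_mahlerMeasure i (Q.map (Int.castRingHom ℂ))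
  rw [natDegree_map_eq_of_injective (Int.castRingHom ℂ).injective_int] at h
  simp only [coeff_map, eq_intCast, Complex.norm_intCast] at h
  refine h.trans (mul_le_mul_of_nonneg_right ?_ h0)
  exact_mod_cast (Nat.choose_le_two_pow _ _).trans (Nat.pow_le_pow_right (by norm_num) hn)

lemma intMahler_le_polyHeight {n : ℕ} {Q : ℤ[X]} (hn : Q.natDegree ≤ n) :
    intMahler Q ≤ (n + 1) * polyHeight Q := by
  refine (mahlerMeasure_le_sum_norm_coeff _).trans ?_
  rw [sum_over_range' _ (by simp) (n + 1)
    ((natDegree_map_le).trans_lt (Nat.lt_succ_of_le hn))]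
  calc _ ≤ ∑ _i ∈ Finset.range (n + 1), (polyHeight Q : ℝ) := by
        refine Finset.sum_le_sum fun i _ => ?_
        simpa using abs_coeff_le_polyHeight Q i
    _ = _ := by simp

lemma aeval_le_polyHeight {n : ℕ} (ξ : ℝ) {Q : ℤ[X]} (hn : Q.natDegree ≤ n) :
    |aeval ξ Q| ≤ (n + 1) * max 1 |ξ| ^ n * polyHeight Q := by
  rw [aeval_eq_sum_range' (Nat.lt_succ_of_le hn)]
  refine (Finset.abs_sum_le_sum_abs _ _).trans ?_
  calc _ ≤ ∑ _i ∈ Finset.range (n + 1), max 1 |ξ| ^ n * (polyHeight Q : ℝ) := by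
        refine Finset.sum_le_sum fun i hi => ?_
        rw [zsmul_eq_mul, abs_mul, abs_pow, mul_comm]
        have h1 : |ξ| ^ i ≤ max 1 |ξ| ^ n :=
          (pow_le_pow_left₀ (abs_nonneg _) (le_max_right _ _) _).trans
            (pow_le_pow_right₀ (le_max_left _ _) (by simpa [Nat.lt_succ_iff] using hi))
        exact mul_le_mul h1 (abs_coeff_le_polyHeight Q i) (abs_nonneg _) (by positivity)
    _ = _ := by simp; ring

/-! ### A lower bound coming from resultants -/

lemma abs_det_le_prod {N : ℕ} (A : Matrix (Fin N) (Fin N) ℝ) (h : Fin N → ℝ)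
    (hA : ∀ i j, |A i j| ≤ h i) : |A.det| ≤ N.factorial * ∏ i, h i := by
  rw [← Matrix.det_transpose, Matrix.det_apply]
  refine (Finset.abs_sum_le_sum_abs _ _).trans ?_
  calc _ ≤ ∑ _σ : Equiv.Perm (Fin N), ∏ i, h i := by
        refine Finset.sum_le_sum fun σ _ => ?_
        rw [Units.smul_def, zsmul_eq_mul, abs_mul, Finset.abs_prod]
        have : |((Equiv.Perm.sign σ : ℤ) : ℝ)| = 1 := by
          rcases Int.units_eq_one_or (Equiv.Perm.sign σ) with h | h <;> simp [h]
        rw [this, one_mul]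
        exact Finset.prod_le_prod (fun _ _ => abs_nonneg _) fun i _ => hA _ _
    _ = _ := by simp [Fintype.card_perm]

/-- Linearly independent integer polynomials, as many as the dimension of the space of polynomials
they live in, cannot all be very small at the same real number. -/
lemma one_le_of_linearIndependent {N : ℕ} (hN : 0 < N) (ξ : ℝ) (Q : Fin N → ℤ[X]) (h : Fin N → ℝ)
    (hdeg : ∀ i, (Q i).natDegree < N) (hli : LinearIndependent ℤ Q)
    (hh : ∀ i, 0 < h i) (hQ : ∀ i j, |((Q i).coeff j : ℝ)| ≤ h i) :
    1 ≤ N.factorial * ((∏ i, h i) * ∑ i, |aeval ξ (Q i)| / h i) := by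
  set M : Matrix (Fin N) (Fin N) ℤ := Matrix.of fun i j => (Q i).coeff j with hM
  have hdet : M.det ≠ 0 := by
    intro h0
    obtain ⟨v, hv, hv0⟩ := Matrix.exists_vecMul_eq_zero_iff.mpr h0
    refine hv (funext fun i => Fintype.linearIndependent_iff.mp hli v ?_ i)
    ext j
    simp only [finsetSum_coeff, coeff_smul, smul_eq_mul, coeff_zero]
    by_cases hj : j < N
    · simpa [Matrix.vecMul, dotProduct, hM] using congrFun hv0 ⟨j, hj⟩
    · refine Finset.sum_eq_zero fun i _ => ?_
      rw [coeff_eq_zero_of_natDegree_lt (by have := hdeg i; omega), mul_zero]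
  set A : Matrix (Fin N) (Fin N) ℝ := M.map (Int.cast : ℤ → ℝ) with hA
  have hdetA : 1 ≤ |A.det| := by
    have : A.det = (M.det : ℝ) := by
      rw [hA]; exact ((Int.castRingHom ℝ).map_det M).symm
    rw [this, ← Int.cast_abs]
    exact_mod_cast Int.one_le_abs hdet
  set x : Fin N → ℝ := fun j => ξ ^ (j : ℕ)
  have hAx : A.mulVec x = fun i => aeval ξ (Q i) := by
    funext i
    rw [aeval_eq_sum_range' (hdeg i), Finset.sum_range]
    simp [Matrix.mulVec, dotProduct, hA, hM, x]
  have hcramer : A.det = ∑ i, A.adjugate ⟨0, hN⟩ i * aeval ξ (Q i) := by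
    have h1 : A.adjugate.mulVec (A.mulVec x) = A.det • x := by
      rw [Matrix.mulVec_mulVec, Matrix.adjugate_mul, Matrix.smul_mulVec, Matrix.one_mulVec]
    have h2 := congrFun h1 ⟨0, hN⟩
    rw [hAx] at h2
    simpa [Matrix.mulVec, dotProduct, x] using h2.symm
  have hadj : ∀ i, |A.adjugate ⟨0, hN⟩ i| ≤ N.factorial * ((∏ i, h i) / h i) := by
    intro i
    rw [Matrix.adjugate_apply]
    refine (abs_det_le_prod _ (Function.update h i 1) fun a b => ?_).trans_eq ?_
    · by_cases hai : a = i
      · subst hai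
        by_cases hb : b = ⟨0, hN⟩
        · subst hb; simp
        · simp [hb]
      · simpa [hai, hA, hM] using hQ a b
    · rw [Finset.prod_update_of_mem (Finset.mem_univ i), one_mul,
        ← Finset.mul_prod_erase Finset.univ h (Finset.mem_univ i), mul_div_cancel_left₀ _ (hh i).ne',
        Finset.sdiff_singleton_eq_erase]
  calc 1 ≤ |A.det| := hdetA
    _ ≤ ∑ i, |A.adjugate ⟨0, hN⟩ i * aeval ξ (Q i)| := by
        rw [hcramer]; exact Finset.abs_sum_le_sum_abs _ _
    _ ≤ ∑ i, N.factorial * ((∏ i, h i) / h i) * |aeval ξ (Q i)| := by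
        refine Finset.sum_le_sum fun i _ => ?_
        rw [abs_mul]
        exact mul_le_mul_of_nonneg_right (hadj i) (abs_nonneg _)
    _ = _ := by
        rw [Finset.mul_sum, Finset.mul_sum]
        exact Finset.sum_congr rfl fun i _ => by ring

lemma linearIndependent_append_of_isRelPrime {P Q : ℤ[X]} (hrel : IsRelPrime P Q)
    (hP : P ≠ 0) (hQ : Q ≠ 0) :
    LinearIndependent ℤ (Fin.append (fun i : Fin Q.natDegree => X ^ (i : ℕ) * P)
      (fun j : Fin P.natDegree => X ^ (j : ℕ) * Q)) := by
  rw [Fintype.linearIndependent_iff]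
  intro g hg
  rw [Fin.sum_univ_add] at hg
  simp only [Fin.append_left, Fin.append_right] at hg
  set U : ℤ[X] := ∑ i : Fin Q.natDegree, C (g (Fin.castAdd _ i)) * X ^ (i : ℕ) with hU
  set V : ℤ[X] := ∑ j : Fin P.natDegree, C (g (Fin.natAdd _ j)) * X ^ (j : ℕ) with hV
  have hUV : U * P + V * Q = 0 := by
    rw [← hg, hU, hV, Finset.sum_mul, Finset.sum_mul]
    simp only [smul_eq_C_mul, mul_assoc]
  have hUdeg : U.degree < Q.natDegree := degree_sum_fin_lt _
  have hVdeg : V.degree < P.natDegree := degree_sum_fin_lt _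
  have hU0 : U = 0 := by
    have : Q ∣ U := hrel.symm.dvd_of_dvd_mul_right ⟨-V, by linear_combination hUV⟩
    exact eq_zero_of_dvd_of_degree_lt this (by rwa [degree_eq_natDegree hQ])
  have hV0 : V = 0 := by
    have : P ∣ V := hrel.dvd_of_dvd_mul_right ⟨-U, by linear_combination hUV⟩
    exact eq_zero_of_dvd_of_degree_lt this (by rwa [degree_eq_natDegree hP])
  intro i
  refine Fin.addCases (fun i => ?_) (fun j => ?_) i
  · have := congrArg (fun R : ℤ[X] => R.coeff i) hU0
    simpa [hU, coeff_C_mul, coeff_X_pow, Fin.val_inj] using this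
  · have := congrArg (fun R : ℤ[X] => R.coeff j) hV0
    simpa [hV, coeff_C_mul, coeff_X_pow, Fin.val_inj] using this

lemma one_le_abs_aeval_of_natDegree_eq_zero {P : ℤ[X]} (hP : P ≠ 0) (h : P.natDegree = 0)
    (ξ : ℝ) : 1 ≤ |aeval ξ P| := by
  rw [eq_C_of_natDegree_eq_zero h] at hP ⊢
  have : P.coeff 0 ≠ 0 := by simpa using hP
  rw [aeval_C, algebraMap_int_eq, eq_intCast, ← Int.cast_abs]
  exact_mod_cast Int.one_le_abs this

lemma one_le_resultant_bound {P Q : ℤ[X]} (hrel : IsRelPrime P Q) (hP : P ≠ 0) (hQ : Q ≠ 0)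
    (hPd : 0 < P.natDegree) (ξ a b : ℝ) (ha : 0 < a) (hb : 0 < b)
    (haP : ∀ i, |(P.coeff i : ℝ)| ≤ a) (hbQ : ∀ i, |(Q.coeff i : ℝ)| ≤ b) :
    1 ≤ ((Q.natDegree + P.natDegree).factorial * (Q.natDegree + P.natDegree : ℕ) *
        max 1 |ξ| ^ (Q.natDegree + P.natDegree)) *
      (a ^ Q.natDegree * b ^ P.natDegree * (|aeval ξ P| / a + |aeval ξ Q| / b)) := by
  set p := P.natDegree with hp
  set q := Q.natDegree with hq
  set F : Fin (q + p) → ℤ[X] := Fin.append (fun i : Fin q => X ^ (i : ℕ) * P)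
      (fun j : Fin p => X ^ (j : ℕ) * Q) with hF
  set h : Fin (q + p) → ℝ := Fin.append (fun _ => a) (fun _ => b) with hh
  have hcoeff : ∀ {R : ℤ[X]} {c : ℝ} (i j : ℕ), 0 < c → (∀ i, |(R.coeff i : ℝ)| ≤ c) →
      |((X ^ i * R).coeff j : ℝ)| ≤ c := by
    intro R c i j hc hR
    rw [coeff_X_pow_mul']
    split_ifs
    · exact hR _
    · simpa using hc.le
  have key := one_le_of_linearIndependent (by omega) ξ F h ?_
    (linearIndependent_append_of_isRelPrime hrel hP hQ) ?_ ?_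
  · refine key.trans ?_
    have hprod : ∏ i, h i = a ^ q * b ^ p := by simp [hh, Fin.prod_univ_add]
    have hx : ∀ i < q + p, |ξ| ^ i ≤ max 1 |ξ| ^ (q + p) := fun i hi =>
      (pow_le_pow_left₀ (abs_nonneg _) (le_max_right _ _) _).trans
        (pow_le_pow_right₀ (le_max_left _ _) hi.le)
    have hsum : ∑ i, |aeval ξ (F i)| / h i ≤ (q + p : ℕ) * (max 1 |ξ| ^ (q + p) *
        (|aeval ξ P| / a + |aeval ξ Q| / b)) := by
      have hle : ∀ i, |aeval ξ (F i)| / h i ≤ max 1 |ξ| ^ (q + p) *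
          (|aeval ξ P| / a + |aeval ξ Q| / b) := by
        intro i
        refine Fin.addCases (fun i => ?_) (fun j => ?_) i
        · simp only [hF, hh, Fin.append_left, map_mul, map_pow, aeval_X, abs_mul, abs_pow,
            mul_div_assoc]
          refine mul_le_mul (hx _ (by omega)) ?_ (by positivity) (by positivity)
          exact le_add_of_nonneg_right (by positivity)
        · simp only [hF, hh, Fin.append_right, map_mul, map_pow, aeval_X, abs_mul, abs_pow,
            mul_div_assoc]
          refine mul_le_mul (hx _ (by omega)) ?_ (by positivity) (by positivity)
          exact le_add_of_nonneg_left (by positivity)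
      refine (Finset.sum_le_sum fun i _ => hle i).trans_eq ?_
      simp
    rw [hprod]
    calc _ ≤ ((q + p).factorial : ℝ) * (a ^ q * b ^ p * ((q + p : ℕ) * (max 1 |ξ| ^ (q + p) *
        (|aeval ξ P| / a + |aeval ξ Q| / b)))) := by gcongr
      _ = _ := by ring
  · intro i
    refine Fin.addCases (fun i => ?_) (fun j => ?_) i
    · simp only [hF, Fin.append_left]
      exact natDegree_mul_le.trans_lt (by rw [natDegree_X_pow]; omega)
    · simp only [hF, Fin.append_right]
      exact natDegree_mul_le.trans_lt (by rw [natDegree_X_pow]; omega)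
  · intro i
    refine Fin.addCases (fun i => ?_) (fun j => ?_) i
    · simpa [hh] using ha
    · simpa [hh] using hb
  · intro i k
    refine Fin.addCases (fun i => ?_) (fun j => ?_) i
    · simpa only [hF, hh, Fin.append_left] using hcoeff i k ha haP
    · simpa only [hF, hh, Fin.append_right] using hcoeff j k hb hbQ

/-- Two relatively prime integer polynomials cannot both be very small at the same real number. -/
lemma exists_resultant_bound (n : ℕ) (ξ : ℝ) : ∃ c : ℝ, 1 ≤ c ∧ ∀ (P Q : ℤ[X]) (p q : ℕ),
    IsRelPrime P Q → P ≠ 0 → Q ≠ 0 → P.natDegree ≤ p → Q.natDegree ≤ q → 1 ≤ p → 1 ≤ q →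
    p ≤ n → q ≤ n →
    1 ≤ c * (intMahler P ^ q * intMahler Q ^ p *
      (|aeval ξ P| / intMahler P + |aeval ξ Q| / intMahler Q)) := by
  set x := max 1 |ξ| with hx
  have hx1 : 1 ≤ x := le_max_left _ _
  set c : ℝ := ((2 * n).factorial * (2 * n + 1 : ℕ) * x ^ (2 * n)) * (2 ^ n) ^ (2 * n) with hc
  have hfac : (1 : ℝ) ≤ (2 * n).factorial := by exact_mod_cast Nat.succ_le_of_lt (Nat.factorial_pos _)
  have h2n : (1 : ℝ) ≤ 2 ^ n := one_le_pow₀ (by norm_num)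
  have hc1 : 1 ≤ c := by
    have h2 : (1 : ℝ) ≤ (2 * n + 1 : ℕ) := by exact_mod_cast Nat.le_add_left _ _
    exact one_le_mul_of_one_le_of_one_le (one_le_mul_of_one_le_of_one_le
      (one_le_mul_of_one_le_of_one_le hfac h2) (one_le_pow₀ hx1)) (one_le_pow₀ h2n)
  refine ⟨c, hc1, fun P Q p q hrel hP hQ hPp hQq hp hq hpn hqn => ?_⟩
  have hMP := one_le_intMahler hP
  have hMQ := one_le_intMahler hQ
  have hMP0 : 0 < intMahler P := by linarith
  have hMQ0 : 0 < intMahler Q := by linarith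
  rcases Nat.eq_zero_or_pos P.natDegree with hP0 | hP0
  · have h1 := one_le_abs_aeval_of_natDegree_eq_zero hP hP0 ξ
    refine one_le_mul_of_one_le_of_one_le hc1 ?_
    calc 1 ≤ intMahler P ^ 1 * 1 * (|aeval ξ P| / intMahler P) := by
          rw [pow_one, mul_one, mul_div_cancel₀ _ hMP0.ne']; exact h1
      _ ≤ _ := by
          gcongr
          · exact one_le_pow₀ hMQ
          · exact le_add_of_nonneg_right (by positivity)
  · have hb : ∀ {R : ℤ[X]}, R.natDegree ≤ n → ∀ i, |(R.coeff i : ℝ)| ≤ 2 ^ n * intMahler R :=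
      fun hR i => (abs_coeff_le_polyHeight _ i).trans (polyHeight_le_intMahler hR)
    have key := one_le_resultant_bound hrel hP hQ hP0 ξ (2 ^ n * intMahler P) (2 ^ n * intMahler Q)
      (by positivity) (by positivity) (hb (hPp.trans hpn)) (hb (hQq.trans hqn))
    refine key.trans ?_
    have hN : Q.natDegree + P.natDegree ≤ 2 * n := by omega
    calc _ ≤ (((2 * n).factorial : ℝ) * (2 * n + 1 : ℕ) * x ^ (2 * n)) *
          ((2 ^ n) ^ (2 * n) * (intMahler P ^ q * intMahler Q ^ p) *
            (|aeval ξ P| / intMahler P + |aeval ξ Q| / intMahler Q)) := by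
          gcongr ?_ * ?_ * ?_ * (?_ * ?_)
          · exact_mod_cast Nat.factorial_le hN
          · exact_mod_cast hN.trans (Nat.le_succ _)
          · exact pow_le_pow_right₀ hx1 hN
          · rw [mul_pow, mul_pow, mul_mul_mul_comm, ← pow_add]
            gcongr
          · gcongr <;> exact le_mul_of_one_le_left (by positivity) h2n
      _ = _ := by rw [hc]; ring

/-! ### Sequences of best approximations -/

namespace IsBestApproxSeq

variable {n : ℕ} {ξ : ℝ} {P : ℕ → ℤ[X]}

lemma abs_aeval_pos (hP : IsBestApproxSeq n ξ P) {k : ℕ} (hk : 1 ≤ k) : 0 < |aeval ξ (P k)| :=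
  (abs_nonneg _).trans_lt (hP.eval_lt k hk)

lemma polyHeight_lt_of_lt (hP : IsBestApproxSeq n ξ P) {i j : ℕ} (hi : 1 ≤ i) (hij : i < j) :
    polyHeight (P i) < polyHeight (P j) := by
  induction j, hij using Nat.le_induction with
  | base => exact hP.height_lt i hi
  | succ j hj ih => exact ih.trans (hP.height_lt j (by omega))

lemma polyHeight_mono (hP : IsBestApproxSeq n ξ P) {i j : ℕ} (hi : 1 ≤ i) (hij : i ≤ j) :
    polyHeight (P i) ≤ polyHeight (P j) := by
  rcases hij.eq_or_lt with rfl | h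
  · rfl
  · exact (hP.polyHeight_lt_of_lt hi h).le

lemma abs_aeval_anti (hP : IsBestApproxSeq n ξ P) {i j : ℕ} (hi : 1 ≤ i) (hij : i ≤ j) :
    |aeval ξ (P j)| ≤ |aeval ξ (P i)| := by
  induction j, hij using Nat.le_induction with
  | base => rfl
  | succ j hj ih => exact (hP.eval_lt j (by omega)).le.trans ih

lemma le_polyHeight (hP : IsBestApproxSeq n ξ P) {k : ℕ} (hk : 1 ≤ k) : k ≤ polyHeight (P k) := by
  induction k, hk using Nat.le_induction with
  | base => exact polyHeight_pos (hP.ne_zero 1 le_rfl)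
  | succ k hk ih => exact Nat.succ_le_of_lt (ih.trans_lt (hP.height_lt k hk))

lemma tendsto_polyHeight (hP : IsBestApproxSeq n ξ P) :
    Tendsto (fun k => (polyHeight (P k) : ℝ)) atTop atTop := by
  refine tendsto_atTop_mono' atTop ?_ tendsto_natCast_atTop_atTop
  filter_upwards [eventually_ge_atTop 1] with k hk
  exact_mod_cast hP.le_polyHeight hk

lemma finite_setOf_polyHeight_le (n H : ℕ) :
    {Q : ℤ[X] | Q.natDegree ≤ n ∧ polyHeight Q ≤ H}.Finite := by
  refine (finite_mahlerMeasure_le n (((n : NNReal) + 1) * H)).subset fun Q hQ => ⟨hQ.1, ?_⟩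
  refine (intMahler_le_polyHeight hQ.1).trans ?_
  push_cast
  gcongr
  exact hQ.2

lemma polyHeight_neg (Q : ℤ[X]) : polyHeight (-Q) = polyHeight Q := by
  simp [polyHeight]

/-- A polynomial of height smaller than the next best approximation is not smaller at `ξ` than the
current one. -/
lemma abs_aeval_le_of_polyHeight_lt (hP : IsBestApproxSeq n ξ P) {k : ℕ} (hk : 1 ≤ k) {Q : ℤ[X]}
    (hQ : Q ≠ 0) (hQn : Q.natDegree ≤ n) (hQH : polyHeight Q < polyHeight (P (k + 1))) :
    |aeval ξ (P k)| ≤ |aeval ξ Q| := by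
  have hfin : {R : ℤ[X] | R ≠ 0 ∧ R.natDegree ≤ n ∧ polyHeight R ≤ polyHeight Q}.Finite :=
    (finite_setOf_polyHeight_le n (polyHeight Q)).subset fun R hR => hR.2
  obtain ⟨R, ⟨hR0, hRn, hRH⟩, hRmin⟩ := Set.exists_min_image _ (fun R => |aeval ξ R|) hfin
    ⟨Q, hQ, hQn, le_rfl⟩
  obtain ⟨j, hj, hjR⟩ := hP.complete R hR0 hRn fun S hS hSn hSH =>
    hRmin S ⟨hS, hSn, hSH.trans hRH⟩
  have hH : polyHeight (P j) = polyHeight R := by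
    rcases hjR with rfl | rfl <;> simp [polyHeight_neg]
  have hE : |aeval ξ (P j)| = |aeval ξ R| := by
    rcases hjR with rfl | rfl <;> simp
  have hjk : j ≤ k := by
    by_contra! h
    have := hP.polyHeight_mono (by omega) (show k + 1 ≤ j by omega)
    omega
  exact ((hP.abs_aeval_anti hj hjk).trans_eq hE).trans (hRmin Q ⟨hQ, hQn, le_rfl⟩)

lemma eventually_abs_aeval_le (hP : IsBestApproxSeq n ξ P) {w : ℝ} (hw : (w : EReal) < wHat n ξ) :
    ∀ᶠ k in atTop, |aeval ξ (P k)| ≤ (polyHeight (P (k + 1)) : ℝ) ^ (-w) := by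
  obtain ⟨_, ⟨v, hv, rfl⟩, hwv⟩ := lt_sSup_iff.mp hw
  have hwv : w < v := EReal.coe_lt_coe_iff.mp hwv
  have hH : Tendsto (fun k => (polyHeight (P (k + 1)) : ℝ)) atTop atTop :=
    hP.tendsto_polyHeight.comp (tendsto_add_atTop_nat 1)
  have h1 := (hH.atTop_div_const (show (0 : ℝ) < 2 by norm_num)).eventually hv
  have h2 := ((tendsto_rpow_atTop (sub_pos.mpr hwv)).comp hH).eventually_ge_atTop ((2 : ℝ) ^ v)
  filter_upwards [h1, h2, eventually_ge_atTop 1] with k ⟨Q, hQn, hQH, hQ0, hQv⟩ hk2 hk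
  have hpos : (0 : ℝ) < polyHeight (P (k + 1)) := by
    exact_mod_cast polyHeight_pos (hP.ne_zero (k + 1) (by omega))
  have hQ : Q ≠ 0 := by rintro rfl; simp at hQ0
  have hlt : polyHeight Q < polyHeight (P (k + 1)) := by
    have : (polyHeight Q : ℝ) < polyHeight (P (k + 1)) := by linarith
    exact_mod_cast this
  refine (hP.abs_aeval_le_of_polyHeight_lt hk hQ hQn hlt).trans (hQv.le.trans ?_)
  set H := (polyHeight (P (k + 1)) : ℝ)
  rw [Real.div_rpow hpos.le (by norm_num), Real.rpow_neg (by norm_num : (0 : ℝ) ≤ 2), div_inv_eq_mul]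
  calc H ^ (-v) * 2 ^ v ≤ H ^ (-v) * H ^ (v - w) := by
        gcongr; exact hk2
    _ = H ^ (-w) := by rw [← Real.rpow_add hpos]; congr 1; ring

lemma tendsto_pow_mul_abs_aeval (hP : IsBestApproxSeq n ξ P) {d : ℕ}
    (hd : ((d : ℝ) : EReal) < wHat n ξ) :
    Tendsto (fun k => (polyHeight (P (k + 1)) : ℝ) ^ d * |aeval ξ (P k)|) atTop (nhds 0) := by
  obtain ⟨w, hdw, hw⟩ := EReal.lt_iff_exists_real_btwn.mp hd
  have hdw : (d : ℝ) < w := by exact_mod_cast hdw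
  have hH : Tendsto (fun k => (polyHeight (P (k + 1)) : ℝ)) atTop atTop :=
    hP.tendsto_polyHeight.comp (tendsto_add_atTop_nat 1)
  have hlim := (tendsto_rpow_neg_atTop (sub_pos.mpr hdw)).comp hH
  refine squeeze_zero' (Eventually.of_forall fun k => by positivity) ?_ hlim
  filter_upwards [hP.eventually_abs_aeval_le hw] with k hk
  have hpos : (0 : ℝ) < polyHeight (P (k + 1)) := by
    exact_mod_cast polyHeight_pos (hP.ne_zero (k + 1) (by omega))
  calc _ ≤ (polyHeight (P (k + 1)) : ℝ) ^ d * (polyHeight (P (k + 1)) : ℝ) ^ (-w) := by gcongr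
    _ = _ := by
      rw [← Real.rpow_natCast, ← Real.rpow_add hpos]
      simp [sub_eq_add_neg]

/-- Consecutive best approximations are linearly independent. -/
lemma eq_zero_of_mul_eq_mul (hP : IsBestApproxSeq n ξ P) {k : ℕ} (hk : 1 ≤ k) {a b : ℤ}
    (hab : C a * P k = C b * P (k + 1)) : a = 0 ∧ b = 0 := by
  have hk0 := hP.ne_zero k hk
  have hk1 := hP.ne_zero (k + 1) (by omega)
  by_contra hne
  have ha : a ≠ 0 := by
    rintro rfl
    have : b = 0 := by simpa [hk1] using hab
    exact hne ⟨rfl, this⟩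
  obtain ⟨c, d, g, hrel, rfl, rfl⟩ := UniqueFactorizationMonoid.exists_reduced_factors a ha b
  have hg : g ≠ 0 := by rintro rfl; simp at ha
  have hcd : C c * P k = C d * P (k + 1) := by
    have hCg : (C g : ℤ[X]) ≠ 0 := by simpa using hg
    refine mul_left_cancel₀ hCg ?_
    simpa [mul_assoc] using hab
  have hcop : IsCoprime (C d : ℤ[X]) (C c) :=
    (isRelPrime_iff_isCoprime.mp hrel.symm).map C
  obtain ⟨R, hR⟩ := hcop.dvd_of_dvd_mul_left ⟨_, hcd⟩
  have hc : c ≠ 0 := by rintro rfl; simp at ha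
  have hd : d ≠ 0 := by rintro rfl; simp [hk0] at hR
  have hR1 : P (k + 1) = C c * R := by
    have hCd : (C d : ℤ[X]) ≠ 0 := by simpa using hd
    refine mul_left_cancel₀ hCd ?_
    rw [← hcd, hR]; ring
  have unit_of_eq : ∀ {j : ℕ} {e : ℤ}, 1 ≤ j → e ≠ 0 → P j = C e * R →
      polyHeight (P j) = polyHeight R := by
    intro j e hj he hje
    have hR0 : R ≠ 0 := by rintro rfl; simp [hP.ne_zero j hj] at hje
    have hheight : ∀ i, (P j).coeff i = e * R.coeff i := fun i => by rw [hje, coeff_C_mul]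
    have hdeg : R.natDegree ≤ n := by
      have := hP.deg_le j hj
      rwa [hje, natDegree_C_mul he] at this
    have hle : polyHeight R ≤ polyHeight (P j) := by
      have : (polyHeight R : ℝ) ≤ polyHeight (P j) := by
        rw [polyHeight_le_iff (Nat.cast_nonneg _)]
        intro i
        refine le_trans ?_ (abs_coeff_le_polyHeight (P j) i)
        rw [hheight, Int.cast_mul, abs_mul]
        refine le_mul_of_one_le_left (abs_nonneg _) ?_
        rw [← Int.cast_abs]; exact_mod_cast Int.one_le_abs he
      exact_mod_cast this
    have hmin := hP.isMin j hj R hR0 hdeg hle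
    have hpos := hP.abs_aeval_pos hj
    rw [hje, map_mul, aeval_C, abs_mul, algebraMap_int_eq, eq_intCast] at hmin hpos
    have he1 : |(e : ℝ)| ≤ 1 := by
      by_contra! h
      have : 0 < |aeval ξ R| := by
        rcases (abs_nonneg (aeval ξ R)).eq_or_lt with h0 | h0
        · rw [← h0] at hpos; simp at hpos
        · exact h0
      nlinarith
    have he2 : |e| = 1 := by
      have h1 : |e| ≤ 1 := by exact_mod_cast he1
      exact le_antisymm h1 (Int.one_le_abs he)
    rcases (abs_eq (zero_le_one)).mp he2 with rfl | rfl <;> simp [hje, polyHeight_neg]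
  have := hP.height_lt k hk
  rw [unit_of_eq hk hd hR, unit_of_eq (by omega) hc hR1] at this
  exact lt_irrefl _ this

/-- Consecutive best approximations form a basis of the lattice of integer points in the plane they
span. -/
lemma exists_int_of_mem_span (hP : IsBestApproxSeq n ξ P) {k : ℕ} (hk : 1 ≤ k) {R : ℤ[X]}
    (hR : ratPoly R ∈ Submodule.span ℚ {ratPoly (P k), ratPoly (P (k + 1))}) :
    ∃ a b : ℤ, R = C a * P k + C b * P (k + 1) := by
  obtain ⟨α, β, hαβ⟩ := Submodule.mem_span_pair.mp hR
  refine ⟨round α, round β, ?_⟩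
  by_contra hne
  set S : ℤ[X] := R - (C (round α) * P k + C (round β) * P (k + 1)) with hS
  have hS0 : S ≠ 0 := sub_ne_zero.mpr hne
  have hSrat : ratPoly S =
      (α - round α) • ratPoly (P k) + (β - round β) • ratPoly (P (k + 1)) := by
    have : ratPoly S = ratPoly R -
        ((round α : ℚ) • ratPoly (P k) + (round β : ℚ) • ratPoly (P (k + 1))) := by
      simp [hS, ratPoly, smul_eq_C_mul]
    rw [this, ← hαβ, sub_smul, sub_smul]
    abel
  have hround : ∀ x : ℚ, |((x - round x : ℚ) : ℝ)| ≤ 1 / 2 := fun x => by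
    rw [← Rat.cast_abs]
    exact (Rat.cast_le.mpr (abs_sub_round x)).trans_eq (by norm_num)
  have hcoeff : ∀ i, (S.coeff i : ℝ) = ((α - round α : ℚ) : ℝ) * (P k).coeff i +
      ((β - round β : ℚ) : ℝ) * (P (k + 1)).coeff i := by
    intro i
    have h := congrArg (fun T : ℚ[X] => ((T.coeff i : ℚ) : ℝ)) hSrat
    simpa [ratPoly] using h
  have haeval : aeval ξ S = ((α - round α : ℚ) : ℝ) * aeval ξ (P k) +
      ((β - round β : ℚ) : ℝ) * aeval ξ (P (k + 1)) := by
    have hrat : ∀ T : ℤ[X], aeval ξ (ratPoly T) = aeval ξ T := fun T =>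
      aeval_map_algebraMap ℚ ξ T
    have h := congrArg (aeval ξ) hSrat
    rw [map_add, map_smul, map_smul, hrat, hrat, hrat] at h
    simpa only [Rat.smul_def] using h
  have habs : ∀ x y : ℝ, |((α - round α : ℚ) : ℝ) * x + ((β - round β : ℚ) : ℝ) * y| ≤
      (|x| + |y|) / 2 := by
    intro x y
    refine (abs_add_le _ _).trans ?_
    rw [abs_mul, abs_mul]
    have h1 := mul_le_mul_of_nonneg_right (hround α) (abs_nonneg x)
    have h2 := mul_le_mul_of_nonneg_right (hround β) (abs_nonneg y)
    linarith
  have hH : (polyHeight (P k) : ℝ) < polyHeight (P (k + 1)) := by exact_mod_cast hP.height_lt k hk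
  have hSH : polyHeight S < polyHeight (P (k + 1)) := by
    have : (polyHeight S : ℝ) ≤ ((polyHeight (P k) : ℝ) + polyHeight (P (k + 1))) / 2 := by
      rw [polyHeight_le_iff (by positivity)]
      intro i
      rw [hcoeff]
      refine (habs _ _).trans ?_
      have h1 := abs_coeff_le_polyHeight (P k) i
      have h2 := abs_coeff_le_polyHeight (P (k + 1)) i
      linarith
    have : (polyHeight S : ℝ) < polyHeight (P (k + 1)) := by linarith
    exact_mod_cast this
  have hSn : S.natDegree ≤ n := by
    rw [natDegree_le_iff_coeff_eq_zero]
    intro i hi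
    have h1 : (P k).coeff i = 0 := coeff_eq_zero_of_natDegree_lt ((hP.deg_le k hk).trans_lt hi)
    have h2 : (P (k + 1)).coeff i = 0 :=
      coeff_eq_zero_of_natDegree_lt ((hP.deg_le (k + 1) (by omega)).trans_lt hi)
    have h := hcoeff i
    rw [h1, h2] at h
    simpa using h
  have h1 := hP.abs_aeval_le_of_polyHeight_lt hk hS0 hSn hSH
  have h2 := habs (aeval ξ (P k)) (aeval ξ (P (k + 1)))
  rw [← haeval] at h2
  have h3 := hP.eval_lt k hk
  linarith

lemma polyHeight_mul_abs_aeval_le (hP : IsBestApproxSeq n ξ P) {k j : ℕ} (hk : 1 ≤ k) (hj : 1 ≤ j)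
    (hH : 2 * polyHeight (P k) < polyHeight (P (k + 1)))
    (h1 : ratPoly (P j) ∈ Submodule.span ℚ {ratPoly (P k), ratPoly (P (k + 1))})
    (h2 : ratPoly (P (j + 1)) ∈ Submodule.span ℚ {ratPoly (P k), ratPoly (P (k + 1))}) :
    polyHeight (P (k + 1)) * |aeval ξ (P k)| ≤
      4 * (polyHeight (P (j + 1)) * |aeval ξ (P j)|) := by
  obtain ⟨a, b, hab⟩ := hP.exists_int_of_mem_span hk h1
  obtain ⟨c, d, hcd⟩ := hP.exists_int_of_mem_span hk h2
  have hdet : a * d - b * c ≠ 0 := by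
    intro h0
    have e1 : C c * P j = C a * P (j + 1) := by
      have h0' : (C (a * d - b * c) : ℤ[X]) = 0 := by rw [h0, C_0]
      simp only [map_sub, map_mul] at h0'
      rw [hab, hcd]
      linear_combination -P (k + 1) * h0'
    have e2 : C d * P j = C b * P (j + 1) := by
      have h0' : (C (a * d - b * c) : ℤ[X]) = 0 := by rw [h0, C_0]
      simp only [map_sub, map_mul] at h0'
      rw [hab, hcd]
      linear_combination P k * h0'
    obtain ⟨-, ha⟩ := hP.eq_zero_of_mul_eq_mul hj e1
    obtain ⟨-, hb⟩ := hP.eq_zero_of_mul_eq_mul hj e2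
    rw [ha, hb] at hab
    exact hP.ne_zero j hj (by simpa using hab)
  obtain ⟨i, hi⟩ := exists_abs_coeff_eq_polyHeight (hP.ne_zero (k + 1) (by omega))
  have hrel : aeval ξ (P j) * (P (j + 1)).coeff i - aeval ξ (P (j + 1)) * (P j).coeff i =
      ((a * d - b * c : ℤ) : ℝ) *
        (aeval ξ (P k) * (P (k + 1)).coeff i - aeval ξ (P (k + 1)) * (P k).coeff i) := by
    have e1 : ∀ e f : ℤ, aeval ξ (C e * P k + C f * P (k + 1)) =
        (e : ℝ) * aeval ξ (P k) + f * aeval ξ (P (k + 1)) := fun e f => by simp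
    have e2 : ∀ e f : ℤ, (((C e * P k + C f * P (k + 1)).coeff i : ℤ) : ℝ) =
        (e : ℝ) * (P k).coeff i + f * (P (k + 1)).coeff i := fun e f => by simp
    rw [hab, hcd, e1, e1, e2, e2]
    push_cast
    ring
  have hge : |aeval ξ (P k) * (P (k + 1)).coeff i - aeval ξ (P (k + 1)) * (P k).coeff i| ≤
      |aeval ξ (P j) * (P (j + 1)).coeff i - aeval ξ (P (j + 1)) * (P j).coeff i| := by
    rw [hrel, abs_mul]
    refine le_mul_of_one_le_left (abs_nonneg _) ?_
    rw [← Int.cast_abs]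
    exact_mod_cast Int.one_le_abs hdet
  have hlow := abs_sub_abs_le_abs_sub (aeval ξ (P k) * (P (k + 1)).coeff i)
    (aeval ξ (P (k + 1)) * (P k).coeff i)
  have hup := abs_sub (aeval ξ (P j) * (P (j + 1)).coeff i) (aeval ξ (P (j + 1)) * (P j).coeff i)
  rw [abs_mul, abs_mul] at hlow hup
  rw [hi] at hlow
  have m1 : |aeval ξ (P (k + 1))| * |((P k).coeff i : ℝ)| ≤ |aeval ξ (P k)| * polyHeight (P k) :=
    mul_le_mul (hP.eval_lt k hk).le (abs_coeff_le_polyHeight _ _) (abs_nonneg _) (abs_nonneg _)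
  have m2 : |aeval ξ (P j)| * |((P (j + 1)).coeff i : ℝ)| ≤
      |aeval ξ (P j)| * polyHeight (P (j + 1)) :=
    mul_le_mul_of_nonneg_left (abs_coeff_le_polyHeight _ _) (abs_nonneg _)
  have m3 : |aeval ξ (P (j + 1))| * |((P j).coeff i : ℝ)| ≤
      |aeval ξ (P j)| * polyHeight (P (j + 1)) :=
    mul_le_mul (hP.eval_lt j hj).le ((abs_coeff_le_polyHeight _ _).trans
      (by exact_mod_cast (hP.height_lt j hj).le)) (abs_nonneg _) (abs_nonneg _)
  have hH' : 2 * (polyHeight (P k) : ℝ) ≤ polyHeight (P (k + 1)) := by exact_mod_cast hH.le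
  have m4 := mul_le_mul_of_nonneg_left hH' (abs_nonneg (aeval ξ (P k)))
  linarith

lemma exists_abs_aeval_mul_le (n : ℕ) (ξ : ℝ) : ∃ c : ℝ, 1 ≤ c ∧ ∀ G R : ℤ[X], G * R ≠ 0 →
    (G * R).natDegree ≤ n → |aeval ξ (G * R)| ≤ c * polyHeight (G * R) * |aeval ξ G| := by
  have hx : 1 ≤ max 1 |ξ| := le_max_left _ _
  have hn1 : (1 : ℝ) ≤ n + 1 := by simp
  have h2n : (1 : ℝ) ≤ 2 ^ n := one_le_pow₀ (by norm_num)
  refine ⟨(n + 1) * max 1 |ξ| ^ n * (2 ^ n * (n + 1)), ?_, fun G R h0 hdeg => ?_⟩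
  · exact one_le_mul_of_one_le_of_one_le (one_le_mul_of_one_le_of_one_le hn1 (one_le_pow₀ hx))
      (one_le_mul_of_one_le_of_one_le h2n hn1)
  · have hG : G ≠ 0 := left_ne_zero_of_mul h0
    have hR : R ≠ 0 := right_ne_zero_of_mul h0
    have hRdeg : R.natDegree ≤ n := by rw [natDegree_mul hG hR] at hdeg; omega
    have hRM : intMahler R ≤ intMahler (G * R) := by
      rw [intMahler_mul]
      exact le_mul_of_one_le_left (mahlerMeasure_nonneg _) (one_le_intMahler hG)
    rw [map_mul, abs_mul, mul_comm]
    refine mul_le_mul_of_nonneg_right ?_ (abs_nonneg _)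
    calc |aeval ξ R| ≤ (n + 1) * max 1 |ξ| ^ n * polyHeight R := aeval_le_polyHeight ξ hRdeg
      _ ≤ (n + 1) * max 1 |ξ| ^ n * (2 ^ n * ((n + 1) * polyHeight (G * R))) := by
          gcongr
          refine (polyHeight_le_intMahler hRdeg).trans ?_
          gcongr
          exact hRM.trans (intMahler_le_polyHeight hdeg)
      _ = _ := by ring

lemma one_le_cast_polyHeight {Q : ℤ[X]} (hQ : Q ≠ 0) : (1 : ℝ) ≤ polyHeight Q := by
  exact_mod_cast polyHeight_pos hQ

/-- A nonconstant prime factor, of degree less than `n`, of a best approximation is not too small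
at `ξ`. -/
lemma exists_prime_factor_bound (hP : IsBestApproxSeq n ξ P)
    (hlim : Tendsto (fun k => (polyHeight (P (k + 1)) : ℝ) ^ (2 * (n - 1)) * |aeval ξ (P k)|)
      atTop (nhds 0)) :
    ∃ c : ℝ, 1 ≤ c ∧ ∀ k, 1 ≤ k → ∀ G : ℤ[X], Prime G → G ∣ P k → 1 ≤ G.natDegree →
      G.natDegree + 1 ≤ n →
      1 ≤ c * (intMahler G ^ (n - 1) * (polyHeight (P k) : ℝ) ^ G.natDegree * |aeval ξ G|) := by
  obtain ⟨r, hr1, hr⟩ := exists_resultant_bound n ξ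
  obtain ⟨s, hs1, hs⟩ := exists_abs_aeval_mul_le n ξ
  set t : ℝ := n + 1 with ht
  have ht1 : 1 ≤ t := by simp [ht]
  have hev : ∀ᶠ k in atTop, r * t ^ (2 * (n - 1)) *
      ((polyHeight (P (k + 1)) : ℝ) ^ (2 * (n - 1)) * |aeval ξ (P k)|) < 1 / 2 := by
    have := hlim.const_mul (r * t ^ (2 * (n - 1)))
    rw [mul_zero] at this
    exact this.eventually_lt_const (by norm_num)
  obtain ⟨i₀, hi₀⟩ := eventually_atTop.mp hev
  set m := max i₀ 1 with hm
  have hm1 : 1 ≤ m := le_max_right _ _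
  have hEm := hP.abs_aeval_pos hm1
  refine ⟨max (2 * r * t ^ n) (s * polyHeight (P m) / |aeval ξ (P m)|), ?_, ?_⟩
  · refine le_max_of_le_left ?_
    have := one_le_pow₀ ht1 (n := n)
    nlinarith
  intro k hk G hG hGk hG1 hGn
  have hG0 := hG.ne_zero
  have hMG := one_le_intMahler hG0
  have hHk := one_le_cast_polyHeight (hP.ne_zero k hk)
  classical
  have hex : ∃ j, 1 ≤ j ∧ G ∣ P j := ⟨k, hk, hGk⟩
  obtain ⟨hj1, hGj⟩ := Nat.find_spec hex
  have hjk : Nat.find hex ≤ k := Nat.find_min' hex ⟨hk, hGk⟩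
  set j := Nat.find hex with hj
  have hpowM : 1 ≤ intMahler G ^ (n - 1) := one_le_pow₀ hMG
  rcases le_or_gt j m with hjm | hjm
  · obtain ⟨R, hR⟩ := hGj
    have h := hs G R (hR ▸ hP.ne_zero j hj1) (hR ▸ hP.deg_le j hj1)
    rw [← hR] at h
    have h1 : |aeval ξ (P m)| ≤ s * polyHeight (P m) * |aeval ξ G| := by
      refine (hP.abs_aeval_anti hj1 hjm).trans (h.trans ?_)
      gcongr
      exact hP.polyHeight_mono hj1 hjm
    calc 1 ≤ s * polyHeight (P m) / |aeval ξ (P m)| * (1 * 1 * |aeval ξ G|) := by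
          rw [one_mul, one_mul, div_mul_eq_mul_div, one_le_div hEm]; exact h1
      _ ≤ _ := by
          gcongr
          · exact le_max_right _ _
          · exact one_le_pow₀ hHk
  · obtain ⟨i, hij⟩ : ∃ i, j = i + 1 := ⟨j - 1, by omega⟩
    have hi1 : 1 ≤ i := by omega
    have hndvd : ¬ G ∣ P i := fun h => Nat.find_min hex (show i < j by omega) ⟨hi1, h⟩
    have hrel : IsRelPrime G (P i) := hG.irreducible.isRelPrime_iff_not_dvd.mpr hndvd
    have hi0 := hP.ne_zero i hi1
    have hres := hr G (P i) G.natDegree n hrel hG0 hi0 le_rfl (hP.deg_le i hi1) hG1 (by omega)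
      (by omega) le_rfl
    have hsmall := hi₀ i (by omega)
    rw [hij] at hGj hjk
    set H : ℝ := (polyHeight (P (i + 1)) : ℝ) with hH
    have hH1 : 1 ≤ H := one_le_cast_polyHeight (hP.ne_zero (i + 1) (by omega))
    have hHk' : H ≤ polyHeight (P k) := by
      rw [hH]
      exact_mod_cast hP.polyHeight_mono (by omega) hjk
    have hMi1 := one_le_intMahler hi0
    have hMi : intMahler (P i) ≤ t * H := by
      refine (intMahler_le_polyHeight (hP.deg_le i hi1)).trans ?_
      rw [ht, hH]
      gcongr
      exact (hP.height_lt i hi1).le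
    have hMGH : intMahler G ≤ t * H := by
      obtain ⟨R, hR⟩ := hGj
      have hR0 : R ≠ 0 := by
        rintro rfl
        exact hP.ne_zero (i + 1) (by omega) (by simpa using hR)
      refine le_trans ?_ (intMahler_le_polyHeight (hP.deg_le (i + 1) (by omega)))
      rw [hR, intMahler_mul]
      exact le_mul_of_one_le_right (by linarith) (one_le_intMahler hR0)
    obtain ⟨d, hd⟩ : ∃ d, G.natDegree = d + 1 := ⟨G.natDegree - 1, by omega⟩
    obtain ⟨l, hl⟩ : ∃ l, n = l + 1 := ⟨n - 1, by omega⟩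
    have hexp : intMahler G ^ n * intMahler (P i) ^ G.natDegree *
        (|aeval ξ G| / intMahler G + |aeval ξ (P i)| / intMahler (P i)) =
        intMahler G ^ (n - 1) * intMahler (P i) ^ G.natDegree * |aeval ξ G| +
        intMahler G ^ n * intMahler (P i) ^ d * |aeval ξ (P i)| := by
      rw [hd, hl, Nat.add_sub_cancel]
      field_simp
      ring
    have hsecond : r * (intMahler G ^ n * intMahler (P i) ^ d * |aeval ξ (P i)|) ≤ 1 / 2 := by
      refine le_trans ?_ hsmall.le
      have htH : 1 ≤ t * H := one_le_mul_of_one_le_of_one_le ht1 hH1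
      calc _ ≤ r * ((t * H) ^ n * (t * H) ^ d * |aeval ξ (P i)|) := by gcongr
        _ ≤ r * ((t * H) ^ (2 * (n - 1)) * |aeval ξ (P i)|) := by
            rw [← pow_add]
            gcongr
            omega
        _ = _ := by rw [mul_pow]; ring
    rw [hexp, mul_add] at hres
    have hfirst : r * (intMahler G ^ (n - 1) * intMahler (P i) ^ G.natDegree * |aeval ξ G|) ≤
        r * t ^ n * (intMahler G ^ (n - 1) * (polyHeight (P k) : ℝ) ^ G.natDegree *
          |aeval ξ G|) := by
      calc _ ≤ r * (intMahler G ^ (n - 1) * (t * polyHeight (P k)) ^ G.natDegree * |aeval ξ G|) := by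
            gcongr
            exact hMi.trans (by gcongr)
        _ = r * t ^ G.natDegree * (intMahler G ^ (n - 1) * (polyHeight (P k) : ℝ) ^ G.natDegree *
          |aeval ξ G|) := by rw [mul_pow]; ring
        _ ≤ _ := by
            gcongr
            omega
    calc 1 ≤ 2 * r * t ^ n * (intMahler G ^ (n - 1) * (polyHeight (P k) : ℝ) ^ G.natDegree *
          |aeval ξ G|) := by linarith
      _ ≤ _ := by
          gcongr
          exact le_max_left _ _

/-- A factor of degree less than `n` of a best approximation is not too small at `ξ`. -/
lemma exists_factor_bound (hP : IsBestApproxSeq n ξ P)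
    (hlim : Tendsto (fun k => (polyHeight (P (k + 1)) : ℝ) ^ (2 * (n - 1)) * |aeval ξ (P k)|)
      atTop (nhds 0)) :
    ∃ c : ℝ, 1 ≤ c ∧ ∀ k, 1 ≤ k → ∀ G : ℤ[X], G ∣ P k → G.natDegree + 1 ≤ n →
      1 ≤ c ^ G.natDegree *
        (intMahler G ^ (n - 1) * (polyHeight (P k) : ℝ) ^ G.natDegree * |aeval ξ G|) := by
  obtain ⟨c, hc1, hc⟩ := hP.exists_prime_factor_bound hlim
  refine ⟨c, hc1, fun k hk G => ?_⟩
  have hconst : ∀ Q : ℤ[X], Q ≠ 0 → Q.natDegree = 0 → 1 ≤ c ^ Q.natDegree *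
      (intMahler Q ^ (n - 1) * (polyHeight (P k) : ℝ) ^ Q.natDegree * |aeval ξ Q|) := by
    intro Q hQ hQ0
    rw [hQ0, pow_zero, pow_zero, one_mul, mul_one]
    exact one_le_mul_of_one_le_of_one_le (one_le_pow₀ (one_le_intMahler hQ))
      (one_le_abs_aeval_of_natDegree_eq_zero hQ hQ0 ξ)
  induction G using UniqueFactorizationMonoid.induction_on_prime with
  | h₁ => exact fun h => absurd (zero_dvd_iff.mp h) (hP.ne_zero k hk)
  | h₂ u hu => exact fun _ _ => hconst u hu.ne_zero (natDegree_eq_zero_of_isUnit hu)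
  | h₃ a p ha hp ih =>
    intro hdvd hdeg
    rw [natDegree_mul hp.ne_zero ha] at hdeg ⊢
    have h1 := ih ((dvd_mul_left a p).trans hdvd) (by omega)
    have h2 : 1 ≤ c ^ p.natDegree *
        (intMahler p ^ (n - 1) * (polyHeight (P k) : ℝ) ^ p.natDegree * |aeval ξ p|) := by
      rcases Nat.eq_zero_or_pos p.natDegree with h0 | h0
      · exact hconst p hp.ne_zero h0
      · refine (hc k hk p hp ((dvd_mul_right p a).trans hdvd) h0 (by omega)).trans ?_
        have : 0 ≤ intMahler p := mahlerMeasure_nonneg _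
        gcongr
        exact le_self_pow₀ hc1 (by omega)
    refine (one_le_mul_of_one_le_of_one_le h2 h1).trans_eq ?_
    rw [intMahler_mul, map_mul, abs_mul]
    ring

/-- Consecutive best approximations satisfy the inequality that a nonvanishing resultant would
give. -/
lemma exists_consecutive_bound (hP : IsBestApproxSeq n ξ P) (hn : 1 ≤ n)
    (hlim : Tendsto (fun k => (polyHeight (P (k + 1)) : ℝ) ^ (2 * (n - 1)) * |aeval ξ (P k)|)
      atTop (nhds 0)) :
    ∃ c : ℝ, 1 ≤ c ∧ ∀ᶠ k in atTop, 1 ≤ c * (|aeval ξ (P k)| *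
      ((polyHeight (P k) : ℝ) ^ (n - 1) * (polyHeight (P (k + 1)) : ℝ) ^ n)) := by
  obtain ⟨r, hr1, hr⟩ := exists_resultant_bound n ξ
  obtain ⟨s, hs1, hs⟩ := hP.exists_factor_bound hlim
  set t : ℝ := n + 1 with ht
  have ht1 : 1 ≤ t := by simp [ht]
  have hev : ∀ᶠ k in atTop, 2 * r * s ^ n * t ^ (2 * (n - 1)) *
      ((polyHeight (P (k + 1)) : ℝ) ^ (2 * (n - 1)) * |aeval ξ (P k)|) < 1 := by
    have := hlim.const_mul (2 * r * s ^ n * t ^ (2 * (n - 1)))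
    rw [mul_zero] at this
    exact this.eventually_lt_const (by norm_num)
  refine ⟨2 * r * t ^ (2 * n - 1), ?_, ?_⟩
  · have := one_le_pow₀ ht1 (n := 2 * n - 1)
    nlinarith
  filter_upwards [hev, eventually_ge_atTop 1] with k hsmall hk
  have hk0 := hP.ne_zero k hk
  have hk1 := hP.ne_zero (k + 1) (by omega)
  obtain ⟨A, B, G, hrel, hA, hB⟩ := UniqueFactorizationMonoid.exists_reduced_factors _ hk0
    (P (k + 1))
  have hG0 : G ≠ 0 := by rintro rfl; simp [eq_comm, hk0] at hA
  have hA0 : A ≠ 0 := by rintro rfl; simp [eq_comm, hk0] at hA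
  have hB0 : B ≠ 0 := by rintro rfl; simp [eq_comm, hk1] at hB
  have hdA : G.natDegree + A.natDegree ≤ n := by
    rw [← natDegree_mul hG0 hA0, hA]; exact hP.deg_le k hk
  have hdB : G.natDegree + B.natDegree ≤ n := by
    rw [← natDegree_mul hG0 hB0, hB]; exact hP.deg_le (k + 1) (by omega)
  have hMA := one_le_intMahler hA0
  have hMB := one_le_intMahler hB0
  have hMG := one_le_intMahler hG0
  have hMk : intMahler G * intMahler A ≤ t * polyHeight (P k) := by
    rw [← intMahler_mul, hA]; exact intMahler_le_polyHeight (hP.deg_le k hk)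
  have hMk1 : intMahler G * intMahler B ≤ t * polyHeight (P (k + 1)) := by
    rw [← intMahler_mul, hB]; exact intMahler_le_polyHeight (hP.deg_le (k + 1) (by omega))
  have hEk : |aeval ξ G| * |aeval ξ A| = |aeval ξ (P k)| := by rw [← abs_mul, ← map_mul, hA]
  have hEk1 : |aeval ξ G| * |aeval ξ B| ≤ |aeval ξ (P k)| := by
    rw [← abs_mul, ← map_mul, hB]; exact (hP.eval_lt k hk).le
  have hHH : (polyHeight (P k) : ℝ) ≤ polyHeight (P (k + 1)) := by
    exact_mod_cast (hP.height_lt k hk).le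
  have hHk := one_le_cast_polyHeight hk0
  have hHk1 := one_le_cast_polyHeight hk1
  -- the resultant of the cofactors, both seen as polynomials of degree at most `m + 1`
  have hres : ∀ m, A.natDegree ≤ m + 1 → B.natDegree ≤ m + 1 → m + 1 ≤ n →
      1 ≤ r * (intMahler A ^ m * intMahler B ^ (m + 1) * |aeval ξ A| +
        intMahler A ^ (m + 1) * intMahler B ^ m * |aeval ξ B|) := by
    intro m h1 h2 h3
    refine (hr A B (m + 1) (m + 1) hrel hA0 hB0 h1 h2 (by omega) (by omega) h3 h3).trans_eq ?_
    congr 1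
    field_simp
    ring
  have hEG : 0 ≤ |aeval ξ G| := abs_nonneg _
  set g := intMahler G
  set x := intMahler A
  set y := intMahler B
  set u := |aeval ξ G|
  set e := |aeval ξ A|
  set f := |aeval ξ B|
  set E := |aeval ξ (P k)|
  set H : ℝ := (polyHeight (P k) : ℝ)
  set H' : ℝ := (polyHeight (P (k + 1)) : ℝ)
  have he0 : 0 ≤ e := abs_nonneg _
  have hf0 : 0 ≤ f := abs_nonneg _
  rcases Nat.eq_zero_or_pos G.natDegree with hd | hd
  · have hu : 1 ≤ u := one_le_abs_aeval_of_natDegree_eq_zero hG0 hd ξ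
    have heE : e ≤ E := (le_mul_of_one_le_left he0 hu).trans_eq hEk
    have hfE : f ≤ E := (le_mul_of_one_le_left hf0 hu).trans hEk1
    have hxH : x ≤ t * H := (le_mul_of_one_le_left (by linarith) hMG).trans hMk
    have hyH : y ≤ t * H' := (le_mul_of_one_le_left (by linarith) hMG).trans hMk1
    obtain ⟨m, rfl⟩ : ∃ m, n = m + 1 := ⟨n - 1, by omega⟩
    refine (hres m (by omega) (by omega) le_rfl).trans ?_
    calc _ ≤ r * ((t * H) ^ m * (t * H') ^ (m + 1) * E + (t * H) ^ (m + 1) * (t * H') ^ m * E) := by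
          gcongr
      _ = r * t ^ (2 * m + 1) * (E * H ^ m * H' ^ m) * (H' + H) := by ring_nf
      _ ≤ r * t ^ (2 * m + 1) * (E * H ^ m * H' ^ m) * (H' + H') := by gcongr
      _ = _ := by
          rw [show 2 * (m + 1) - 1 = 2 * m + 1 by omega, Nat.add_sub_cancel]; ring
  · exfalso
    have hdn : G.natDegree + 1 ≤ n := by
      by_contra! h
      have hA' := eq_C_of_natDegree_eq_zero (show A.natDegree = 0 by omega)
      have hB' := eq_C_of_natDegree_eq_zero (show B.natDegree = 0 by omega)
      have : C (B.coeff 0) * P k = C (A.coeff 0) * P (k + 1) := by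
        rw [← hA', ← hB', ← hA, ← hB]; ring
      have h0 := (hP.eq_zero_of_mul_eq_mul hk this).1
      rw [h0, C_0] at hB'
      exact hB0 hB'
    obtain ⟨d, hd'⟩ : ∃ d, G.natDegree = d + 1 := ⟨G.natDegree - 1, by omega⟩
    obtain ⟨m, hm⟩ : ∃ m, n = d + m + 2 := ⟨n - (d + 2), by omega⟩
    have hfac := hs (k + 1) (by omega) G ⟨B, hB.symm⟩ hdn
    rw [hd'] at hfac
    have hR := hres m (by omega) (by omega) (by omega)
    set Z := t * H' with hZ
    have hH'Z : H' ≤ Z := le_mul_of_one_le_left (by linarith) ht1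
    have hgx : g * x ≤ Z := hMk.trans (mul_le_mul_of_nonneg_left hHH (by linarith))
    have hgZ : g ≤ Z := (le_mul_of_one_le_right (by linarith) hMB).trans hMk1
    have hgpow : g ^ (n - 1) ≤ g ^ (2 * m + 1) * Z ^ d := by
      calc g ^ (n - 1) ≤ g ^ (2 * m + 1 + d) := pow_le_pow_right₀ hMG (by omega)
        _ = g ^ (2 * m + 1) * g ^ d := pow_add _ _ _
        _ ≤ _ := by gcongr
    refine lt_irrefl (1 : ℝ) (lt_of_le_of_lt ?_ hsmall)
    calc (1 : ℝ) ≤ (s ^ (d + 1) * (g ^ (n - 1) * H' ^ (d + 1) * u)) *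
          (r * (x ^ m * y ^ (m + 1) * e + x ^ (m + 1) * y ^ m * f)) :=
          one_le_mul_of_one_le_of_one_le hfac hR
      _ ≤ (s ^ n * (g ^ (2 * m + 1) * Z ^ d * Z ^ (d + 1) * u)) *
          (r * (x ^ m * y ^ (m + 1) * e + x ^ (m + 1) * y ^ m * f)) := by
          gcongr
          omega
      _ = r * s ^ n * Z ^ (2 * d + 1) * ((g * x) ^ m * (g * y) ^ (m + 1) * (u * e) +
          (g * x) ^ (m + 1) * (g * y) ^ m * (u * f)) := by ring
      _ ≤ r * s ^ n * Z ^ (2 * d + 1) * (Z ^ m * Z ^ (m + 1) * E + Z ^ (m + 1) * Z ^ m * E) := by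
          gcongr
          exact hEk.le
      _ = 2 * r * s ^ n * t ^ (2 * (n - 1)) * (H' ^ (2 * (n - 1)) * E) := by
          rw [show 2 * (n - 1) = 2 * d + 2 * m + 2 by omega, hZ]
          ring_nf

end IsBestApproxSeq

/-! ### The main inequality -/

lemma exists_threshold_of_log_bounds {n w ε : ℝ} (hn : 2 ≤ n) (hw : 2 * n - 2 < w) (hε : 0 < ε) :
    ∃ v, 2 * n - 2 < v ∧ v < w ∧ ∀ K : ℝ, ∃ M : ℝ, 1 ≤ M ∧ ∀ a b c e : ℝ, M ≤ a → a ≤ b →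
      b ≤ c → c ≤ e → (v - n) * b ≤ (n - 1) * a + K → (v - 1) * c ≤ (n - 1) * (a + b) + K →
      (v - n) * e ≤ (n - 1) * c + K →
      e / b ≤ ((n - 1) * w - b / a * (w - n)) / (b / a * (w - 1) * (w - n)) * (e / c) + ε := by
  obtain ⟨κ, hκ⟩ : ∃ κ, κ = w - n := ⟨_, rfl⟩
  have hκ0 : 0 < κ := by linarith
  have hw1 : 0 < w - 1 := by linarith
  set η := ε * (w - 1) * κ / (4 * n) with hη
  have hη0 : 0 < η := by positivity
  have hq : 0 < κ * (2 * n - 1) + n := by nlinarith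
  set δ := min (κ / 2) (min ((w - (2 * n - 2)) / 2) (κ * η / (κ * (2 * n - 1) + n))) with hδ
  have hδ0 : 0 < δ := by
    refine lt_min (by linarith) (lt_min (by linarith) (by positivity))
  have hδ1 : δ ≤ κ / 2 := min_le_left _ _
  have hδ2 : δ ≤ (w - (2 * n - 2)) / 2 := (min_le_right _ _).trans (min_le_left _ _)
  have hδ3 : δ * (κ * (2 * n - 1) + n) ≤ κ * η := by
    rw [← le_div_iff₀ hq]
    exact (min_le_right _ _).trans (min_le_right _ _)
  refine ⟨w - δ, by linarith, by linarith, fun K => ?_⟩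
  refine ⟨max 1 (max K ((κ + n) * K / (κ * η))), le_max_left _ _, ?_⟩
  intro a b c e hMa hab hbc hce h1 h2 h3
  have ha1 : 1 ≤ a := (le_max_left _ _).trans hMa
  have haK : K ≤ a := ((le_max_left _ _).trans (le_max_right _ _)).trans hMa
  have hKη : (κ + n) * K ≤ κ * η * b := by
    have : (κ + n) * K / (κ * η) ≤ b :=
      (((le_max_right _ _).trans (le_max_right _ _)).trans hMa).trans hab
    rw [div_le_iff₀ (by positivity)] at this
    linarith
  have hb0 : 0 < b := by linarith
  have hc0 : 0 < c := by linarith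
  have he0 : 0 < e := by linarith
  have ha0 : 0 < a := by linarith
  have hcb : c ≤ (2 * n - 1) * b := by
    have : 1 * c ≤ (w - δ - 1) * c := by
      refine mul_le_mul_of_nonneg_right ?_ hc0.le
      linarith
    have : (n - 1) * (a + b) ≤ (n - 1) * (b + b) := by
      refine mul_le_mul_of_nonneg_left ?_ ?_ <;> linarith
    linarith
  have hec : e * κ ≤ 2 * n * c := by
    have : κ / 2 * e ≤ (w - δ - n) * e := by
      refine mul_le_mul_of_nonneg_right ?_ he0.le
      linarith
    linarith
  have hδcb : δ * (κ * c + n * b) ≤ κ * η * b := by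
    calc δ * (κ * c + n * b) ≤ δ * (κ * ((2 * n - 1) * b) + n * b) := by gcongr
      _ = δ * (κ * (2 * n - 1) + n) * b := by ring
      _ ≤ _ := by gcongr
  have hmain : κ * (w - 1) * c ≤ (n - 1) * w * a - κ * b + 2 * (κ * η * b) := by
    have e1 := mul_le_mul_of_nonneg_left h2 hκ0.le
    have e2 := mul_le_mul_of_nonneg_left h1 (show 0 ≤ n by linarith)
    have hwκ : w = κ + n := by linarith
    subst hwκ
    linarith
  have hcoef : ((n - 1) * w - b / a * (w - n)) / (b / a * (w - 1) * (w - n)) =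
      ((n - 1) * w * a - κ * b) / (b * (w - 1) * κ) := by
    rw [← hκ]
    field_simp
  have hlow : c / b - 2 * η / (w - 1) ≤ ((n - 1) * w * a - κ * b) / (b * (w - 1) * κ) := by
    rw [le_div_iff₀ (by positivity)]
    have : (c / b - 2 * η / (w - 1)) * (b * (w - 1) * κ) =
        κ * (w - 1) * c - 2 * (κ * η * b) := by
      field_simp
    linarith
  rw [hcoef]
  have hec0 : 0 ≤ e / c := by positivity
  have hfin := mul_le_mul_of_nonneg_right hlow hec0
  have h4 : (c / b - 2 * η / (w - 1)) * (e / c) = e / b - 2 * η / (w - 1) * (e / c) := by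
    field_simp
  have h5 : 2 * η / (w - 1) * (e / c) ≤ ε := by
    have : 2 * η / (w - 1) * (e / c) = ε * (e * κ / (2 * n * c)) := by
      rw [hη]; field_simp; norm_num
    rw [this]
    refine mul_le_of_le_one_right hε.le ?_
    rw [div_le_one (by positivity)]
    exact hec
  linarith

/-- If `H_{k+1} > 2 H_k`, only finitely many consecutive best approximations from `P_k` on lie in
the plane spanned by `P_k` and `P_{k+1}`. -/
lemma IsBestApproxSeq.bddAbove_ellSet {n : ℕ} {ξ : ℝ} {P : ℕ → ℤ[X]} (hP : IsBestApproxSeq n ξ P)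
    (hn : 2 ≤ n)
    (hlim : Tendsto (fun k => (polyHeight (P (k + 1)) : ℝ) ^ (2 * (n - 1)) * |aeval ξ (P k)|)
      atTop (nhds 0)) {k : ℕ} (hk : 1 ≤ k)
    (hH : 2 * polyHeight (P k) < polyHeight (P (k + 1))) : BddAbove (ellSet P (k + 1)) := by
  have hpos : 0 < polyHeight (P (k + 1)) * |aeval ξ (P k)| / 4 := by
    have := hP.abs_aeval_pos hk
    have : (0 : ℝ) < polyHeight (P (k + 1)) := by exact_mod_cast (by omega)
    positivity
  obtain ⟨N, hN⟩ := eventually_atTop.mp (hlim.eventually_lt_const hpos)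
  refine ⟨N + 1, fun m ⟨hkm, hm⟩ => ?_⟩
  by_contra! hlt
  obtain ⟨j, rfl⟩ : ∃ j, m = j + 2 := ⟨m - 2, by omega⟩
  simp only [Nat.add_sub_cancel] at hm
  have h := hP.polyHeight_mul_abs_aeval_le hk (show 1 ≤ j by omega) hH
    (hm j (by omega) (by omega)) (hm (j + 1) (by omega) (by omega))
  have h' := hN j (by omega)
  have h1 : (1 : ℝ) ≤ polyHeight (P (j + 1)) :=
    IsBestApproxSeq.one_le_cast_polyHeight (hP.ne_zero (j + 1) (by omega))
  have h2 : (polyHeight (P (j + 1)) : ℝ) * |aeval ξ (P j)| ≤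
      (polyHeight (P (j + 1)) : ℝ) ^ (2 * (n - 1)) * |aeval ξ (P j)| :=
    mul_le_mul_of_nonneg_right (le_self_pow₀ h1 (by omega)) (abs_nonneg _)
  linarith

/-- with `w = ŵ_n(ξ)`,
`log H_ℓ / log H_k ≤ (((n-1)w - τ_k(w-n))/(τ_k(w-1)(w-n)))·τ_ℓ + ε`. -/
theorem stmt10 (n : ℕ) (hn : 2 ≤ n) (ξ : ℝ)
    (h1 : ((2*(n:ℝ)-2 : ℝ) : EReal) < wHat n ξ) (h2 : wHat n ξ < ⊤)
    (P : ℕ → Polynomial ℤ) (hP : IsBestApproxSeq n ξ P)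
    (ε : ℝ) (hε : 0 < ε) :
    ∃ k0 : ℕ, ∀ k ≥ k0, polyHeight (P k) > 2 * polyHeight (P (k-1)) →
      ∃ ℓ : ℕ, IsGreatest (ellSet P k) ℓ ∧
        Real.log (polyHeight (P ℓ)) / Real.log (polyHeight (P k)) ≤
          ((((n:ℝ)-1) * (wHat n ξ).toReal - tauk P k * ((wHat n ξ).toReal - (n:ℝ))) /
            (tauk P k * ((wHat n ξ).toReal - 1) * ((wHat n ξ).toReal - (n:ℝ)))) *
            tauk P ℓ + ε := by
  have hwcoe : ((wHat n ξ).toReal : EReal) = wHat n ξ :=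
    EReal.coe_toReal h2.ne ((bot_le.trans_lt h1).ne')
  set w := (wHat n ξ).toReal with hw
  have hnw : 2 * (n : ℝ) - 2 < w := by rwa [← hwcoe, EReal.coe_lt_coe_iff] at h1
  have hn' : (2 : ℝ) ≤ n := by exact_mod_cast hn
  obtain ⟨v, -, hvw, hv⟩ := exists_threshold_of_log_bounds hn' hnw hε
  have hlim := hP.tendsto_pow_mul_abs_aeval (d := 2 * (n - 1)) (by
    convert h1 using 2
    push_cast [Nat.cast_sub (show 1 ≤ n by omega)]
    ring)
  obtain ⟨c₀, hc₀, hcons⟩ := hP.exists_consecutive_bound (by omega) hlim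
  have hlogc₀ : 0 ≤ Real.log c₀ := Real.log_nonneg hc₀
  have hlog4 : 0 ≤ Real.log 4 := Real.log_nonneg (by norm_num)
  obtain ⟨M, -, hM⟩ := hv (Real.log c₀ + Real.log 4)
  have hbound := hP.eventually_abs_aeval_le (w := v) (by rwa [← hwcoe, EReal.coe_lt_coe_iff])
  have hlarge : ∀ᶠ k in atTop, M ≤ Real.log (polyHeight (P k)) :=
    (Real.tendsto_log_atTop.comp hP.tendsto_polyHeight).eventually_ge_atTop M
  obtain ⟨N, hN⟩ := eventually_atTop.mp
    ((hcons.and (hbound.and hlarge)).and (eventually_ge_atTop 1))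
  have hlogmono : ∀ {i j : ℕ}, 1 ≤ i → i ≤ j →
      Real.log (polyHeight (P i)) ≤ Real.log (polyHeight (P j)) := fun {i j} hi hij =>
    Real.log_le_log (by exact_mod_cast polyHeight_pos (hP.ne_zero i hi))
      (by exact_mod_cast hP.polyHeight_mono hi hij)
  have hlogeval : ∀ k, N ≤ k →
      Real.log |aeval ξ (P k)| ≤ -v * Real.log (polyHeight (P (k + 1))) := by
    intro k hk
    obtain ⟨⟨-, hb, -⟩, hk1⟩ := hN k hk
    have hpos : (0 : ℝ) < polyHeight (P (k + 1)) := by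
      exact_mod_cast polyHeight_pos (hP.ne_zero (k + 1) (by omega))
    rw [← Real.log_rpow hpos]
    exact Real.log_le_log (hP.abs_aeval_pos hk1) hb
  have hlogcons : ∀ k, N ≤ k → (v - n) * Real.log (polyHeight (P (k + 1))) ≤
      (n - 1) * Real.log (polyHeight (P k)) + (Real.log c₀ + Real.log 4) := by
    intro k hk
    obtain ⟨⟨hc, -, -⟩, hk1⟩ := hN k hk
    have hE := hlogeval k hk
    have hE0 := (hP.abs_aeval_pos hk1).ne'
    have hH0 : (polyHeight (P k) : ℝ) ≠ 0 := by
      exact_mod_cast (polyHeight_pos (hP.ne_zero k hk1)).ne'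
    have hH1 : (polyHeight (P (k + 1)) : ℝ) ≠ 0 := by
      exact_mod_cast (polyHeight_pos (hP.ne_zero (k + 1) (by omega))).ne'
    have := Real.log_nonneg hc
    rw [Real.log_mul (by linarith) (by positivity), Real.log_mul hE0 (by positivity),
      Real.log_mul (by positivity) (by positivity), Real.log_pow, Real.log_pow,
      Nat.cast_sub (by omega), Nat.cast_one] at this
    linarith
  refine ⟨N + 1, fun k hk hHk => ?_⟩
  obtain ⟨i, rfl⟩ : ∃ i, k = i + 1 := ⟨k - 1, by omega⟩
  rw [Nat.add_sub_cancel] at hHk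
  have hi : N ≤ i := by omega
  obtain ⟨⟨-, -, hiM⟩, hi1⟩ := hN i hi
  have hbdd := hP.bddAbove_ellSet hn hlim hi1 hHk
  have hne : (ellSet P (i + 1)).Nonempty := by
    refine ⟨i + 2, by omega, fun j hj1 hj2 => Submodule.subset_span ?_⟩
    rw [Nat.add_sub_cancel] at *
    obtain rfl | rfl : j = i ∨ j = i + 1 := by omega
    · exact Or.inl rfl
    · exact Or.inr rfl
  obtain ⟨ℓ, hℓ⟩ : ∃ ℓ, IsGreatest (ellSet P (i + 1)) ℓ :=
    ⟨_, Nat.sSup_mem hne hbdd, fun m hm => le_csSup hbdd hm⟩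
  refine ⟨ℓ, hℓ, ?_⟩
  obtain ⟨hiℓ, hmem⟩ := hℓ.1
  obtain ⟨j, rfl⟩ : ∃ j, ℓ = j + 2 := ⟨ℓ - 2, by omega⟩
  simp only [Nat.add_sub_cancel] at hmem
  have hplane := hP.polyHeight_mul_abs_aeval_le hi1 (show 1 ≤ j by omega) hHk
    (hmem j (by omega) (by omega)) (hmem (j + 1) (by omega) (by omega))
  have hEi := hP.abs_aeval_pos hi1
  have hEj := hP.abs_aeval_pos (show 1 ≤ j by omega)
  have hHi : (0 : ℝ) < polyHeight (P (i + 1)) := by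
    exact_mod_cast polyHeight_pos (hP.ne_zero (i + 1) (by omega))
  have hHj : (0 : ℝ) < polyHeight (P (j + 1)) := by
    exact_mod_cast polyHeight_pos (hP.ne_zero (j + 1) (by omega))
  have hlogplane := Real.log_le_log (by positivity) hplane
  rw [Real.log_mul hHi.ne' hEi.ne', Real.log_mul (by norm_num) (by positivity),
    Real.log_mul hHj.ne' hEj.ne'] at hlogplane
  have hEj' := hlogeval j (by omega)
  obtain ⟨⟨hc, -, -⟩, -⟩ := hN i hi
  have hHi0 : (polyHeight (P i) : ℝ) ≠ 0 := by
    exact_mod_cast (polyHeight_pos (hP.ne_zero i hi1)).ne'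
  have hlogc := Real.log_nonneg hc
  rw [Real.log_mul (by linarith) (by positivity), Real.log_mul hEi.ne' (by positivity),
    Real.log_mul (by positivity) (by positivity), Real.log_pow, Real.log_pow,
    Nat.cast_sub (by omega), Nat.cast_one] at hlogc
  have := hM _ _ _ _ hiM (hlogmono hi1 (show i ≤ i + 1 by omega))
    (hlogmono (by omega) (show i + 1 ≤ j + 1 by omega))
    (hlogmono (by omega) (show j + 1 ≤ j + 2 by omega)) (hlogcons i hi)
    (by linarith) (hlogcons (j + 1) (by omega))
  simpa only [tauk, Nat.add_sub_cancel, show j + 2 - 1 = j + 1 by omega] using this
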